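/- (Milgram) Let L be an even lattice with discriminant form (L*/L, q_L) and signature (n₊, n₋). Then (1/√|L*/L|) · Σ_{x ∈ L*/L} e^{πi q_L(x)} = e^{2πi (n₊ − n₋)/8} in ℂ, where e^{πi q_L(x)} is well-defined because q_L(x) lies in ℚ/2ℤ. -/

import Mathlib

open scoped BigOperators

noncomputable section

/-- The group `ℚ/ℤ`. -/
abbrev QmodZ : Type := ℚ ⧸ AddSubgroup.zmultiples (1 : ℚ)

/-- The group `ℚ/2ℤ`. -/
abbrev Qmod2Z : Type := ℚ ⧸ AddSubgroup.zmultiples (2 : ℚ)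

/-- The isomorphism `ℚ/2ℤ → ℚ/ℤ` induced by dividing by `2`. -/
noncomputable def halfHom : Qmod2Z →+ QmodZ :=
  QuotientAddGroup.map _ _ (AddMonoidHom.mk' (fun x : ℚ => x / 2) (fun a b => add_div a b 2))
    (by
      intro x hx
      obtain ⟨k, rfl⟩ := AddSubgroup.mem_zmultiples_iff.mp hx
      refine AddSubgroup.mem_zmultiples_iff.mpr ⟨k, ?_⟩
      show k • (1:ℚ) = (k • (2:ℚ)) / 2
      push_cast [zsmul_eq_mul]
      ring)

/-- The bilinear form `b(x,y) = (q(x+y) - q(x) - q(y))/2 ∈ ℚ/ℤ` associated to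
`q : A → ℚ/2ℤ`. -/
def bForm {A : Type*} [AddCommGroup A] (q : A → Qmod2Z) (x y : A) : QmodZ :=
  halfHom (q (x + y) - q x - q y)

/-- `q : A → ℚ/2ℤ` is a finite quadratic space structure on the finite abelian group `A`
if the associated form `b` is `ℤ`-bilinear (i.e. biadditive) and nondegenerate. -/
structure IsFiniteQuadraticSpace {A : Type*} [AddCommGroup A] [Finite A]
    (q : A → Qmod2Z) : Prop where
  add_left : ∀ x x' y, bForm q (x + x') y = bForm q x y + bForm q x' y
  add_right : ∀ x y y', bForm q x (y + y') = bForm q x y + bForm q x y'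
  nondeg : ∀ x, (∀ y, bForm q x y = 0) → x = 0

/-- Two quadratic forms are isometric if some group isomorphism carries one to the other. -/
def FQSIsometric {A B : Type*} [AddCommGroup A] [AddCommGroup B]
    (qA : A → Qmod2Z) (qB : B → Qmod2Z) : Prop :=
  ∃ e : A ≃+ B, ∀ x, qB (e x) = qA x

/-- An even lattice, given by its rank and Gram matrix: the Gram matrix is symmetric,
has even diagonal (so `(x,x)` is always even) and is nondegenerate. -/
structure EvenLattice : Type where
  n : ℕ
  B : Matrix (Fin n) (Fin n) ℤ
  symm : B.IsSymm
  even_diag : ∀ i, 2 ∣ B i i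
  nondeg : B.det ≠ 0

/-- The bilinear form of `L` extended to `R^n` for any commutative ring `R ⊇ ℤ`. -/
def formR (L : EvenLattice) (R : Type*) [CommRing R] (x y : Fin L.n → R) : R :=
  ∑ i, ∑ j, (L.B i j : R) * x i * y j

theorem formR_zero_left (L : EvenLattice) (R : Type*) [CommRing R] (y : Fin L.n → R) :
    formR L R 0 y = 0 := by
  simp [formR]

theorem formR_add_left (L : EvenLattice) (R : Type*) [CommRing R] (x x' y : Fin L.n → R) :
    formR L R (x + x') y = formR L R x y + formR L R x' y := by
  simp [formR, mul_add, add_mul, Finset.sum_add_distrib]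

theorem formR_neg_left (L : EvenLattice) (R : Type*) [CommRing R] (x y : Fin L.n → R) :
    formR L R (-x) y = -formR L R x y := by
  simp [formR, Finset.sum_neg_distrib]

/-- `L` and `M` are isometric over `R`. -/
def IsometricOver (R : Type*) [CommRing R] (L M : EvenLattice) : Prop :=
  ∃ e : (Fin L.n → R) ≃ₗ[R] (Fin M.n → R), ∀ x y, formR M R (e x) (e y) = formR L R x y

/-- `L` and `M` lie in the same genus: they are isometric over `ℤ_p` for all primes `p`
and over `ℝ`. -/
def SameGenus (L M : EvenLattice) : Prop :=
  (∀ (p : ℕ) [Fact p.Prime], IsometricOver ℤ_[p] L M) ∧ IsometricOver ℝ L M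

/-- The subgroup of integral vectors in `ℚ^n`, i.e. the lattice `L` itself inside `L ⊗ ℚ`. -/
def intSub (L : EvenLattice) : AddSubgroup (Fin L.n → ℚ) where
  carrier := {x | ∀ i, ∃ m : ℤ, x i = m}
  zero_mem' := fun i => ⟨0, by simp⟩
  add_mem' := by
    intro x y hx hy i
    obtain ⟨mx, hmx⟩ := hx i
    obtain ⟨my, hmy⟩ := hy i
    exact ⟨mx + my, by simp [hmx, hmy]⟩
  neg_mem' := by
    intro x hx i
    obtain ⟨m, hm⟩ := hx i
    exact ⟨-m, by simp [hm]⟩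

/-- The dual lattice of a subgroup `K` of `L ⊗ ℚ`:
all vectors pairing integrally with every element of `K`. -/
def dualOf (L : EvenLattice) (K : AddSubgroup (Fin L.n → ℚ)) : AddSubgroup (Fin L.n → ℚ) where
  carrier := {x | ∀ y ∈ K, ∃ m : ℤ, formR L ℚ x y = m}
  zero_mem' := fun y _ => ⟨0, by simp [formR_zero_left]⟩
  add_mem' := by
    intro x x' hx hx' y hy
    obtain ⟨m, hm⟩ := hx y hy
    obtain ⟨m', hm'⟩ := hx' y hy
    exact ⟨m + m', by rw [formR_add_left, hm, hm']; push_cast; ring⟩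
  neg_mem' := by
    intro x hx y hy
    obtain ⟨m, hm⟩ := hx y hy
    exact ⟨-m, by rw [formR_neg_left, hm]; push_cast; ring⟩

/-- The dual lattice `L^*` of `L`. -/
abbrev dualSub (L : EvenLattice) : AddSubgroup (Fin L.n → ℚ) := dualOf L (intSub L)

/-- The discriminant group `K^*/K` of a subgroup `K` of `L ⊗ ℚ`. -/
abbrev discGroupOf (L : EvenLattice) (K : AddSubgroup (Fin L.n → ℚ)) : Type :=
  dualOf L K ⧸ K.addSubgroupOf (dualOf L K)

/-- The discriminant group `L^*/L`. -/
abbrev discGroup (L : EvenLattice) : Type := discGroupOf L (intSub L)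

/-- The discriminant form on `K^*/K`, `q(x + K) = (x,x) mod 2ℤ`
(defined via a choice of representative; it is independent of this choice). -/
noncomputable def discQOf (L : EvenLattice) (K : AddSubgroup (Fin L.n → ℚ)) :
    discGroupOf L K → Qmod2Z :=
  fun a => (QuotientAddGroup.mk (formR L ℚ (a.out : Fin L.n → ℚ) (a.out : Fin L.n → ℚ)) : Qmod2Z)

/-- The discriminant form `q_L` on `L^*/L`. -/
noncomputable def discQ (L : EvenLattice) : discGroup L → Qmod2Z := discQOf L (intSub L)

/-- `n₊`: the maximal dimension of a positive definite subspace of `L ⊗ ℝ`. -/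
noncomputable def sigPlus (L : EvenLattice) : ℕ :=
  sSup {d : ℕ | ∃ W : Submodule ℝ (Fin L.n → ℝ), Module.finrank ℝ W = d ∧
    ∀ x ∈ W, x ≠ 0 → 0 < formR L ℝ x x}

/-- `n₋`: the maximal dimension of a negative definite subspace of `L ⊗ ℝ`. -/
noncomputable def sigMinus (L : EvenLattice) : ℕ :=
  sSup {d : ℕ | ∃ W : Submodule ℝ (Fin L.n → ℝ), Module.finrank ℝ W = d ∧
    ∀ x ∈ W, x ≠ 0 → formR L ℝ x x < 0}

end

/-- `e^{πi a}` for `a ∈ ℚ/2ℤ`, defined via a choice of representative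
(on which it does not depend, since `exp (πi ·)` has period `2`). -/
noncomputable def expPiI (a : Qmod2Z) : ℂ :=
  Complex.exp (Real.pi * Complex.I * (a.out : ℂ))

open Complex Filter Topology HurwitzZeta in
theorem gauss_theta (d : ℕ) [NeZero d] (hd : Even d) (t : ℝ) (ht : 0 < t) :
    (∑ k : Fin d, cexp (Real.pi * I * (k : ℂ) ^ 2 / d) * (t : ℂ) ^ (1 / 2 : ℂ) *
      (cosKernel ((((k : ℕ) : ℝ) / d : ℝ) : UnitAddCircle) t : ℂ)) =
    jacobiTheta (1 / d + I / (t * d ^ 2)) := by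
  have hd0 : (d : ℝ) ≠ 0 := by exact_mod_cast NeZero.ne d
  have hdc : (d : ℂ) ≠ 0 := by exact_mod_cast NeZero.ne d
  have htc : (t : ℂ) ≠ 0 := by exact_mod_cast ht.ne'
  set τ : ℂ := 1 / d + I / (t * d ^ 2) with hτ
  have him : 0 < τ.im := by
    have : τ = ((1 / d : ℝ) : ℂ) + ((1 / (t * d ^ 2) : ℝ) : ℂ) * I := by
      rw [hτ]; push_cast; ring
    rw [this]
    simp only [add_im, ofReal_im, mul_im, ofReal_re, I_im, I_re]
    have : 0 < d := Nat.pos_of_ne_zero (NeZero.ne d)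
    norm_num
    positivity
  have hsum : Summable (fun n : ℤ => cexp (Real.pi * I * (n : ℂ) ^ 2 * τ)) := by
    have := (hasSum_jacobiTheta₂_term 0 him).summable
    simpa [jacobiTheta₂_term] using this
  obtain ⟨e, he⟩ := hd
  have hfac : ∀ (k : Fin d), HasSum (fun m : ℤ => cexp (Real.pi * I * ((m * d + (k : ℕ) : ℤ) : ℂ) ^ 2 * τ))
      (cexp (Real.pi * I * (k : ℂ) ^ 2 / d) * (t : ℂ) ^ (1 / 2 : ℂ) *
      (cosKernel ((((k : ℕ) : ℝ) / d : ℝ) : UnitAddCircle) t : ℂ)) := by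
    intro k
    have h1 := hasSum_int_evenKernel (((k : ℕ) : ℝ) / d) (t := 1 / t) (by positivity)
    rw [evenKernel_functional_equation, one_div_one_div] at h1
    have h2 := (hasSum_ofReal.mpr h1).mul_left (cexp (Real.pi * I * (k : ℂ) ^ 2 / d))
    refine (congrArg₂ (fun f a => HasSum f a) ?_ ?_).mpr h2
    · funext m
      rw [ofReal_exp, ← Complex.exp_add]
      have : (Real.pi * I * ((m * d + (k : ℕ) : ℤ) : ℂ) ^ 2 * τ) =
        (Real.pi * I * (k : ℂ) ^ 2 / d + ((-Real.pi * (m + (k : ℕ) / d) ^ 2 * (1 / t) : ℝ) : ℂ)) +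
          ((m * (k : ℕ) + m ^ 2 * e : ℤ) : ℂ) * (2 * Real.pi * I) := by
        have hde : (d : ℂ) = e + e := by exact_mod_cast he
        have : Real.pi * I * ((m * d + (k : ℕ) : ℤ) : ℂ) ^ 2 * (I / (t * d ^ 2)) =
            ((-Real.pi * (m + (k : ℕ) / d) ^ 2 * (1 / t) : ℝ) : ℂ) := by
          push_cast
          field_simp
          rw [I_sq]; ring
        rw [hτ, mul_add, this]
        have h3 : (e : ℂ) = d / 2 := by rw [hde]; ring
        push_cast
        rw [h3]
        field_simp
        ring
      rw [this, Complex.exp_add _ (_ * (2 * Real.pi * I)), Complex.exp_int_mul_two_pi_mul_I, mul_one]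
    · rw [mul_assoc]
      congr 1
      push_cast
      congr 1
      rw [ofReal_cpow (by positivity)]
      push_cast
      rw [one_div (t : ℂ), ← ofReal_inv, ← one_div, ← ofReal_one, ← ofReal_ofNat, ← ofReal_div, ← ofReal_cpow (by positivity),
        ← ofReal_cpow (by positivity), ← ofReal_div]
      congr 1
      rw [one_div t, Real.inv_rpow ht.le]
      simp
  have h := (Int.divModEquiv d).symm.tsum_eq (fun n : ℤ => cexp (Real.pi * I * (n : ℂ) ^ 2 * τ))
  have hs2 := (Int.divModEquiv d).symm.summable_iff.mpr hsum
  rw [jacobiTheta, ← h, ← (Equiv.prodComm _ _).tsum_eq, Summable.tsum_prod, tsum_fintype]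
  · refine Finset.sum_congr rfl fun k _ => ?_
    rw [← (hfac k).tsum_eq]
    rfl
  · exact (Equiv.prodComm (Fin d) ℤ).summable_iff.mpr hs2

open Complex Filter Topology HurwitzZeta in
theorem gauss_sum_eq (d : ℕ) [NeZero d] (hd : Even d) :
    (∑ k : Fin d, cexp (Real.pi * I * (k : ℂ) ^ 2 / d)) =
     (Real.sqrt d : ℂ) * cexp (Real.pi * I / 4) := by
  have hd0 : (d : ℝ) ≠ 0 := by exact_mod_cast NeZero.ne d
  have hdp : (0 : ℝ) < d := by exact_mod_cast Nat.pos_of_ne_zero (NeZero.ne d)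
  have hdc : (d : ℂ) ≠ 0 := by exact_mod_cast NeZero.ne d
  have hcos : ∀ a : UnitAddCircle, Tendsto (fun t => (cosKernel a t : ℂ)) atTop (𝓝 1) := by
    intro a
    obtain ⟨p, hp, hO⟩ := isBigO_atTop_cosKernel_sub a
    have h0 : Tendsto (fun x : ℝ => Real.exp (-p * x)) atTop (𝓝 0) := by
      apply Real.tendsto_exp_atBot.comp
      exact tendsto_id.const_mul_atTop_of_neg (by linarith)
    have := (hO.trans_tendsto h0).add_const 1
    simp only [sub_add_cancel, zero_add] at this
    exact (continuous_ofReal.tendsto 1).comp this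
  have hL : Tendsto (fun t : ℝ => ∑ k : Fin d, cexp (Real.pi * I * (k : ℂ) ^ 2 / d) *
      (cosKernel ((((k : ℕ) : ℝ) / d : ℝ) : UnitAddCircle) t : ℂ)) atTop
      (𝓝 (∑ k : Fin d, cexp (Real.pi * I * (k : ℂ) ^ 2 / d))) := by
    refine tendsto_finsetSum _ fun k _ => ?_
    simpa using (hcos _).const_mul (cexp (Real.pi * I * (k : ℂ) ^ 2 / d))
  -- the right-hand side
  have hθ : Tendsto (fun t : ℝ => jacobiTheta (I * t - 1 / d)) atTop (𝓝 1) := by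
    have h1 : Tendsto (fun t : ℝ => I * (t : ℂ) - 1 / d) atTop (comap im atTop) := by
      rw [tendsto_comap_iff]
      have : (im ∘ fun t : ℝ => I * (t : ℂ) - 1 / d) = id := by
        ext t
        have : (1 / (d : ℂ)) = ((1 / d : ℝ) : ℂ) := by push_cast; rfl
        simp [this]
      rw [this]; exact tendsto_id
    have h0 : Tendsto (fun τ : ℂ => Real.exp (-Real.pi * τ.im)) (comap im atTop) (𝓝 0) := by
      refine Real.tendsto_exp_atBot.comp ?_
      exact tendsto_comap.const_mul_atTop_of_neg (by simp [Real.pi_pos])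
    have := ((isBigO_at_im_infty_jacobiTheta_sub_one.trans_tendsto h0).comp h1).add_const 1
    simpa [Function.comp_def] using this
  have key : ∀ t : ℝ, 0 < t → (∑ k : Fin d, cexp (Real.pi * I * (k : ℂ) ^ 2 / d) *
      (cosKernel ((((k : ℕ) : ℝ) / d : ℝ) : UnitAddCircle) t : ℂ)) =
      1 / (-I * (1 / d + I / (t * d ^ 2))) ^ (1 / 2 : ℂ) *
      (1 / (d * t / (t * d + I)) ^ (1 / 2 : ℂ)) * jacobiTheta (I * t - 1 / d) := by
    intro t ht
    have htc : (t : ℂ) ≠ 0 := by exact_mod_cast ht.ne'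
    have hth : (t : ℂ) ^ (1 / 2 : ℂ) ≠ 0 := by simp [cpow_eq_zero_iff, htc]
    have hg := gauss_theta d hd t ht
    have hI : (t * d + I : ℂ) ≠ 0 := by
      intro h
      have := congrArg im h
      simp at this
    have e1 : -1 / (1 / d + I / (t * d ^ 2) : ℂ) = d * I / (t * d + I) - d := by
      have : (1 / d + I / (t * d ^ 2) : ℂ) = (t * d + I) / (t * d ^ 2) := by field_simp
      rw [this]; field_simp; ring
    have e2 : -1 / (d * I / (t * d + I) : ℂ) = I * t - 1 / d := by
      field_simp
      ring_nf
      rw [I_sq]; ring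
    have e3 : jacobiTheta (d * I / (t * d + I) - d) = jacobiTheta (d * I / (t * d + I)) := by
      obtain ⟨e, he⟩ := hd
      have : ∀ (m : ℕ) (τ : ℂ), jacobiTheta (τ - (m + m : ℕ)) = jacobiTheta τ := by
        intro m
        induction m with
        | zero => simp
        | succ m ih =>
          intro τ
          rw [← jacobiTheta_two_add, ← ih τ]
          congr 1; push_cast; ring
      rw [← this e (d * I / (t * d + I)), he]
    rw [jacobiTheta_eq_jacobiTheta₂, jacobiTheta₂_functional_equation, zero_div,
      ← jacobiTheta_eq_jacobiTheta₂, e1, e3, jacobiTheta_eq_jacobiTheta₂ (_ / _),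
      jacobiTheta₂_functional_equation, zero_div, ← jacobiTheta_eq_jacobiTheta₂, e2] at hg
    simp only [ne_eq, OfNat.ofNat_ne_zero, not_false_eq_true, zero_pow, mul_zero, zero_div,
      Complex.exp_zero, mul_one] at hg
    have e4 : (-I * (d * I / (t * d + I)) : ℂ) ^ (1 / 2 : ℂ) * (t : ℂ) ^ (1 / 2 : ℂ) =
        (d * t / (t * d + I)) ^ (1 / 2 : ℂ) := by
      have h5 : (-I * (d * I / (t * d + I)) : ℂ) = d / (t * d + I) := by
        rw [← mul_div_assoc]; congr 1; ring_nf; rw [I_sq]; ring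
      have h6 : (d / (t * d + I) : ℂ) ≠ 0 := div_ne_zero hdc hI
      rw [h5, show (d * t / (t * d + I) : ℂ) = (t : ℝ) * (d / (t * d + I)) by ring,
        cpow_def_of_ne_zero (mul_ne_zero htc h6), cpow_def_of_ne_zero h6, cpow_def_of_ne_zero htc,
        Complex.log_ofReal_mul ht h6, ← Complex.exp_add, ofReal_log ht.le]
      congr 1; ring
    have e5 : (-I * (d * I / (t * d + I)) : ℂ) ^ (1 / 2 : ℂ) ≠ 0 := by
      rw [Ne, cpow_eq_zero_iff]
      simp [hdc, hI]
    have : (∑ k : Fin d, cexp (Real.pi * I * (k : ℂ) ^ 2 / d) *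
      (cosKernel ((((k : ℕ) : ℝ) / d : ℝ) : UnitAddCircle) t : ℂ)) * (t : ℂ) ^ (1 / 2 : ℂ) =
       1 / (-I * (1 / d + I / (t * d ^ 2))) ^ (1 / 2 : ℂ) *
      (1 / (-I * (d * I / (t * d + I)) : ℂ) ^ (1 / 2 : ℂ)  * jacobiTheta (I * t - 1 / d)) := by
      rw [← hg, Finset.sum_mul]
      refine Finset.sum_congr rfl fun k _ => by ring
    rw [← e4]
    rw [← mul_left_inj' hth, this]
    field_simp
  have hinv : Tendsto (fun t : ℝ => (t : ℂ)⁻¹) atTop (𝓝 0) := by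
    have := (continuous_ofReal.tendsto 0).comp tendsto_inv_atTop_zero
    simpa [Function.comp_def] using this
  have hR1 : Tendsto (fun t : ℝ => -I * (1 / d + I / (t * d ^ 2) : ℂ)) atTop (𝓝 (-I / d)) := by
    have := ((hinv.const_mul (I / d ^ 2 : ℂ)).const_add (1 / d : ℂ)).const_mul (-I)
    rw [mul_zero, add_zero, mul_one_div] at this
    refine this.congr fun t => ?_
    congr 2
    rw [← div_eq_mul_inv, div_div]; ring
  have hR2 : Tendsto (fun t : ℝ => (d * t / (t * d + I) : ℂ)) atTop (𝓝 1) := by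
    have h1 := ((hinv.const_mul (I / d : ℂ)).const_add (1 : ℂ)).inv₀ (by simp)
    rw [mul_zero, add_zero, inv_one] at h1
    refine h1.congr' ?_
    filter_upwards [eventually_gt_atTop 0] with t ht
    have htc : (t : ℂ) ≠ 0 := by exact_mod_cast ht.ne'
    have : (t * d + I : ℂ) = (d * t) * (1 + I / d * (t : ℂ)⁻¹) := by field_simp
    rw [this, div_mul_eq_div_div, div_self (mul_ne_zero hdc htc), one_div]
  have hsl : (-I / d : ℂ) ∈ slitPlane := by
    right
    have : (-I / d : ℂ) = ((-1 / d : ℝ) : ℂ) * I := by push_cast; ring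
    rw [this]
    simp [hd0]
  have hne : (-I / d : ℂ) ^ (1 / 2 : ℂ) ≠ 0 := by
    rw [Ne, cpow_eq_zero_iff]; simp [hdc]
  have hR : Tendsto (fun t : ℝ => 1 / (-I * (1 / d + I / (t * d ^ 2) : ℂ)) ^ (1 / 2 : ℂ) *
      (1 / (d * t / (t * d + I)) ^ (1 / 2 : ℂ)) * jacobiTheta (I * t - 1 / d)) atTop
      (𝓝 (1 / (-I / d : ℂ) ^ (1 / 2 : ℂ) * (1 / 1 ^ (1 / 2 : ℂ)) * 1)) := by
    refine Tendsto.mul (Tendsto.mul ?_ ?_) hθ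
    · exact tendsto_const_nhds.div ((continuousAt_cpow_const hsl).tendsto.comp hR1) hne
    · exact tendsto_const_nhds.div ((continuousAt_cpow_const (by simp)).tendsto.comp hR2) (by simp)
  have hfin := tendsto_nhds_unique (hL.congr' ?_) hR
  swap
  · filter_upwards [eventually_gt_atTop 0] with t ht using key t ht
  rw [hfin]
  have : (-I / d : ℂ) ^ (1 / 2 : ℂ) = (Real.sqrt d : ℂ)⁻¹ * cexp (-(Real.pi * I / 4)) := by
    have h1 : (-I / d : ℂ) = ((d : ℝ)⁻¹ : ℝ) * (-I) := by push_cast; ring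
    rw [h1, cpow_def_of_ne_zero (by simp [hdc]),  Complex.log_ofReal_mul (by positivity) (by simp), log_neg_I, add_mul, Complex.exp_add,
      Real.sqrt_eq_rpow, ofReal_cpow hdp.le, cpow_def_of_ne_zero (by simpa using hdc)]
    rw [← Complex.exp_neg, Real.log_inv, ofReal_neg, ofReal_log hdp.le]
    congr 2
    · push_cast; ring
    · ring
  rw [this, Complex.exp_neg]
  simp
  ring
theorem formR_eq (L : EvenLattice) (R : Type*) [CommRing R] (x y : Fin L.n → R) :
    formR L R x y = x ⬝ᵥ ((L.B.map (Int.cast : ℤ → R)).mulVec y) := by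
  simp only [formR, dotProduct, Matrix.mulVec, Finset.mul_sum, Matrix.map_apply]
  refine Finset.sum_congr rfl fun i _ => Finset.sum_congr rfl fun j _ => by ring

theorem exists_diag (L : EvenLattice) : ∃ (P : Matrix (Fin L.n) (Fin L.n) ℤ) (d : Fin L.n → ℤ),
    P.det ≠ 0 ∧ P.transpose * L.B * P = Matrix.diagonal d := by
  classical
  let Bq : Matrix (Fin L.n) (Fin L.n) ℚ := L.B.map (Int.cast : ℤ → ℚ)
  have hsym : LinearMap.IsSymm (Matrix.toBilin' Bq) := by
    refine ⟨fun x y => ?_⟩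
    simp only [Matrix.toBilin'_apply', RingHom.id_apply]
    have : Bq.transpose = Bq := by
      ext i j
      simp only [Bq, Matrix.transpose_apply, Matrix.map_apply]
      rw [L.symm.apply]
    rw [Matrix.dotProduct_mulVec, ← Matrix.mulVec_transpose, this, dotProduct_comm]
  have : Invertible (2 : ℚ) := invertibleOfNonzero (by norm_num)
  obtain ⟨v0, hv0⟩ := LinearMap.BilinForm.exists_orthogonal_basis hsym
  let e : Fin (Module.finrank ℚ (Fin L.n → ℚ)) ≃ Fin L.n := finCongr (by simp)
  let v := v0.reindex e
  have hv : ∀ i j, i ≠ j → Matrix.toBilin' Bq (v i) (v j) = 0 := by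
    intro i j hij
    simp only [v, Module.Basis.reindex_apply]
    exact hv0 (by simpa using hij)
  obtain ⟨N, hN⟩ := IsLocalization.exist_integer_multiples_of_finite (nonZeroDivisors ℤ)
    (fun p : Fin L.n × Fin L.n => v p.2 p.1)
  have hN0 : (N : ℤ) ≠ 0 := nonZeroDivisors.ne_zero N.2
  have hN' : ∀ i j, ∃ z : ℤ, (z : ℚ) = (N : ℤ) * v j i := by
    intro i j
    obtain ⟨z, hz⟩ := hN (i, j)
    refine ⟨z, ?_⟩
    simpa [zsmul_eq_mul] using hz
  choose p hp using hN'
  let P : Matrix (Fin L.n) (Fin L.n) ℤ := Matrix.of p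
  have hP : P.map (Int.cast : ℤ → ℚ) = ((N : ℤ) : ℚ) • (Pi.basisFun ℚ (Fin L.n)).toMatrix v := by
    ext i j
    simp [P, hp, Module.Basis.toMatrix_apply]
  have hcomp : ∀ i j, (((P.transpose * L.B * P) i j : ℤ) : ℚ) =
      (N : ℤ) ^ 2 * Matrix.toBilin' Bq (v i) (v j) := by
    intro i j
    simp only [Matrix.mul_apply, Matrix.transpose_apply, Matrix.toBilin'_apply, P, Matrix.of_apply,
      Int.cast_sum, Int.cast_mul, hp, Bq, Matrix.map_apply, Finset.sum_mul, Finset.mul_sum]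
    rw [Finset.sum_comm]
    refine Finset.sum_congr rfl fun a _ => Finset.sum_congr rfl fun b _ => by ring
  refine ⟨P, fun i => (P.transpose * L.B * P) i i, ?_, ?_⟩
  · intro h
    have h1 : (P.map (Int.cast : ℤ → ℚ)).det = 0 := by
      have := (Int.castRingHom ℚ).map_det P
      rw [h, map_zero] at this
      exact this.symm
    rw [hP, Matrix.det_smul] at h1
    have h2 : ((Pi.basisFun ℚ (Fin L.n)).toMatrix v).det ≠ 0 := by
      rw [← Module.Basis.det_apply]
      exact ((Pi.basisFun ℚ (Fin L.n)).isUnit_det v).ne_zero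
    have h3 : ((N : ℤ) : ℚ) ≠ 0 := by exact_mod_cast hN0
    exact (mul_ne_zero (pow_ne_zero _ h3) h2) h1
  · ext i j
    by_cases hij : i = j
    · subst hij; simp
    · rw [Matrix.diagonal_apply_ne _ hij]
      have := hcomp i j
      rw [hv i j hij, mul_zero] at this
      exact_mod_cast this

theorem sig_eq (L : EvenLattice) (P : Matrix (Fin L.n) (Fin L.n) ℤ) (d : Fin L.n → ℤ)
    (hP : P.det ≠ 0) (hd : P.transpose * L.B * P = Matrix.diagonal d) :
    sigPlus L = {i | 0 < d i}.ncard ∧ sigMinus L = {i | d i < 0}.ncard := by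
  classical
  let Br : Matrix (Fin L.n) (Fin L.n) ℝ := L.B.map (Int.cast : ℤ → ℝ)
  let Pr : Matrix (Fin L.n) (Fin L.n) ℝ := P.map (Int.cast : ℤ → ℝ)
  let Q : QuadraticForm ℝ (Fin L.n → ℝ) := (Matrix.toBilin' Br).toQuadraticMap
  have hQ : ∀ x, Q x = formR L ℝ x x := by
    intro x
    simp only [Q, LinearMap.BilinMap.toQuadraticMap_apply, Matrix.toBilin'_apply', formR_eq, Br]
  have hdet : Pr.det ≠ 0 := by
    have := (Int.castRingHom ℝ).map_det P
    have h2 : Pr.det = ((P.det : ℤ) : ℝ) := this.symm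
    rw [h2]; exact_mod_cast hP
  have hdr : Pr.transpose * Br * Pr = Matrix.diagonal (fun i => (d i : ℝ)) := by
    have := congrArg (fun M : Matrix (Fin L.n) (Fin L.n) ℤ => M.map (Int.castRingHom ℝ)) hd
    simp only [Matrix.map_mul, Matrix.transpose_map] at this
    refine (this.trans ?_)
    rw [Matrix.diagonal_map (map_zero _)]
    rfl
  have : Invertible Pr := Matrix.invertibleOfIsUnitDet _ (isUnit_iff_ne_zero.mpr hdet)
  have heq : QuadraticMap.Equivalent Q (QuadraticMap.weightedSumSquares ℝ (fun i => (d i : ℝ))) := by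
    refine QuadraticMap.Equivalent.symm ⟨⟨Matrix.toLinearEquiv' Pr inferInstance, fun x => ?_⟩⟩
    have h1 : ∀ y, Q y = y ⬝ᵥ (Br.mulVec y) := fun y => by rw [hQ, formR_eq]
    change Q (Pr.mulVec x) = _
    rw [h1, ← Matrix.vecMul_transpose, ← Matrix.dotProduct_mulVec, Matrix.mulVec_mulVec, Matrix.vecMul_transpose, 
      Matrix.mulVec_mulVec, hdr]
    simp only [dotProduct, Matrix.mulVec_diagonal, QuadraticMap.weightedSumSquares_apply, smul_eq_mul]
    refine Finset.sum_congr rfl fun i _ => by ring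
  constructor
  · have h1 := (sigPos_isGreatest Q).csSup_eq
    have h2 := QuadraticForm.sigPos_of_equiv_weightedSumSquares heq
    rw [h2] at h1
    simp only [Int.cast_pos] at h1
    rw [← h1, sigPlus]
    congr 1
    ext r
    refine exists_congr fun V => and_congr Iff.rfl ?_
    simp [QuadraticMap.PosDef, hQ]
  · have h1 := (sigNeg_isGreatest Q).csSup_eq
    have h2 := QuadraticForm.sigNeg_of_equiv_weightedSumSquares heq
    rw [h2] at h1
    simp only [Int.cast_lt_zero] at h1
    rw [← h1, sigMinus]
    congr 1
    ext r
    refine exists_congr fun V => and_congr Iff.rfl ?_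
    simp [QuadraticMap.PosDef, hQ]

theorem formR_symm (L : EvenLattice) (R : Type*) [CommRing R] (x y : Fin L.n → R) :
    formR L R x y = formR L R y x := by
  simp only [formR]
  rw [Finset.sum_comm]
  refine Finset.sum_congr rfl fun i _ => Finset.sum_congr rfl fun j _ => ?_
  rw [L.symm.apply]; ring

theorem formR_add_right (L : EvenLattice) (R : Type*) [CommRing R] (x y y' : Fin L.n → R) :
    formR L R x (y + y') = formR L R x y + formR L R x y' := by
  rw [formR_symm, formR_add_left, formR_symm L R y, formR_symm L R y']

theorem formR_even (L : EvenLattice) (z : Fin L.n → ℤ) : ∃ m : ℤ, formR L ℤ z z = 2 * m := by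
  suffices h : ((formR L ℤ z z : ℤ) : ZMod 2) = 0 from (ZMod.intCast_zmod_eq_zero_iff_dvd _ 2).mp h
  simp only [formR, Int.cast_id]
  push_cast
  rw [← Finset.sum_product']
  refine Finset.sum_involution (fun p _ => (p.2, p.1)) ?_ ?_ ?_ ?_
  · rintro ⟨i, j⟩ _
    simp only
    rw [L.symm.apply i j]
    have : (2 : ZMod 2) = 0 := rfl
    linear_combination ((L.B i j : ZMod 2) * (z i) * (z j)) * this
  · rintro ⟨i, j⟩ _ h heq
    simp only [Prod.mk.injEq] at heq
    obtain ⟨rfl, _⟩ := heq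
    apply h
    have : ((L.B j j : ℤ) : ZMod 2) = 0 := (ZMod.intCast_zmod_eq_zero_iff_dvd _ 2).mpr (L.even_diag _)
    simp [this]
  · intros; simp
  · intros; rfl

theorem formR_cast (L : EvenLattice) (z w : Fin L.n → ℤ) :
    formR L ℚ (fun i => (z i : ℚ)) (fun i => (w i : ℚ)) = ((formR L ℤ z w : ℤ) : ℚ) := by
  simp [formR]

theorem exp_two_pi_int (r : ℚ) : Complex.exp (2 * Real.pi * Complex.I * (r : ℂ)) = 1 ↔ ∃ m : ℤ, r = m := by
  rw [Complex.exp_eq_one_iff]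
  refine exists_congr fun m => ?_
  rw [show (2 * Real.pi * Complex.I * (r : ℂ)) = (r : ℂ) * (2 * Real.pi * Complex.I) by ring,
    mul_left_inj' Complex.two_pi_I_ne_zero]
  norm_cast

/-- `e^{πi (x,x)}` -/
noncomputable def fL (L : EvenLattice) (x : Fin L.n → ℚ) : ℂ :=
  Complex.exp (Real.pi * Complex.I * ((formR L ℚ x x : ℚ) : ℂ))

/-- `e^{2πi (x,y)}` -/
noncomputable def cL (L : EvenLattice) (x y : Fin L.n → ℚ) : ℂ :=
  Complex.exp (2 * Real.pi * Complex.I * ((formR L ℚ x y : ℚ) : ℂ))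

theorem fL_add (L : EvenLattice) (x y : Fin L.n → ℚ) :
    fL L (x + y) = fL L x * fL L y * cL L x y := by
  simp only [fL, cL, ← Complex.exp_add, formR_add_left, formR_add_right, formR_symm L ℚ y x]
  congr 1
  push_cast; ring

theorem cL_add (L : EvenLattice) (x y y' : Fin L.n → ℚ) :
    cL L x (y + y') = cL L x y * cL L x y' := by
  simp only [cL, ← Complex.exp_add, formR_add_right]
  congr 1
  push_cast; ring

theorem cL_add_left (L : EvenLattice) (x x' y : Fin L.n → ℚ) :
    cL L (x + x') y = cL L x y * cL L x' y := by
  simp only [cL, ← Complex.exp_add, formR_add_left]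
  congr 1
  push_cast; ring

theorem mem_intSub_iff (L : EvenLattice) (x : Fin L.n → ℚ) :
    x ∈ intSub L ↔ ∃ z : Fin L.n → ℤ, x = fun i => (z i : ℚ) := by
  constructor
  · intro h
    choose z hz using h
    exact ⟨z, funext hz⟩
  · rintro ⟨z, rfl⟩ i
    exact ⟨z i, rfl⟩

theorem fL_int (L : EvenLattice) (x : Fin L.n → ℚ) (hx : x ∈ intSub L) : fL L x = 1 := by
  obtain ⟨z, rfl⟩ := (mem_intSub_iff L x).mp hx
  obtain ⟨m, hm⟩ := formR_even L z
  rw [fL, formR_cast, hm, Complex.exp_eq_one_iff]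
  refine ⟨m, ?_⟩
  push_cast; ring

theorem cL_int (L : EvenLattice) (x y : Fin L.n → ℚ) (hx : x ∈ dualSub L) (hy : y ∈ intSub L) :
    cL L x y = 1 := by
  rw [cL, exp_two_pi_int]
  exact hx y hy

theorem intSub_le_dual (L : EvenLattice) : intSub L ≤ dualSub L := by
  intro x hx y hy
  obtain ⟨z, rfl⟩ := (mem_intSub_iff L x).mp hx
  obtain ⟨w, rfl⟩ := (mem_intSub_iff L y).mp hy
  exact ⟨_, formR_cast L z w⟩

theorem mk_out_sub (L : EvenLattice) (x : dualSub L) :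
    (((QuotientAddGroup.mk x : discGroup L).out : dualSub L) : Fin L.n → ℚ) - x ∈ intSub L := by
  have h : (QuotientAddGroup.mk x : discGroup L) = QuotientAddGroup.mk (QuotientAddGroup.mk x : discGroup L).out := by
    exact (Quotient.out_eq' _).symm
  have := QuotientAddGroup.eq.mp h
  rw [AddSubgroup.mem_addSubgroupOf] at this
  simpa [sub_eq_neg_add] using this

theorem expPiI_mk (r : ℚ) : expPiI (QuotientAddGroup.mk r) = Complex.exp (Real.pi * Complex.I * (r : ℂ)) := by
  have h : (QuotientAddGroup.mk r : Qmod2Z) = QuotientAddGroup.mk (QuotientAddGroup.mk r : Qmod2Z).out := by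
    exact (Quotient.out_eq' _).symm
  obtain ⟨k, hk⟩ := AddSubgroup.mem_zmultiples_iff.mp (QuotientAddGroup.eq.mp h)
  have h2 : (QuotientAddGroup.mk r : Qmod2Z).out = r + k * 2 := by
    rw [zsmul_eq_mul] at hk; rw [hk]; ring
  rw [expPiI, h2, Complex.exp_eq_exp_iff_exists_int]
  exact ⟨k, by push_cast; ring⟩

theorem expPiI_discQ (L : EvenLattice) (a : discGroup L) : expPiI (discQ L a) = fL L (a.out : Fin L.n → ℚ) :=
  expPiI_mk _

theorem fL_mk (L : EvenLattice) (x : dualSub L) :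
    fL L ((QuotientAddGroup.mk x : discGroup L).out : Fin L.n → ℚ) = fL L (x : Fin L.n → ℚ) := by
  have h := mk_out_sub L x
  set y := (((QuotientAddGroup.mk x : discGroup L).out : dualSub L) : Fin L.n → ℚ) with hy
  rw [show y = x + (y - x) by abel, fL_add, fL_int L _ h, cL_int L _ _ x.2 h]
  simp

theorem cL_mk (L : EvenLattice) (x y : dualSub L) :
    cL L x ((QuotientAddGroup.mk y : discGroup L).out : Fin L.n → ℚ) = cL L x (y : Fin L.n → ℚ) := by
  have h := mk_out_sub L y
  set w := (((QuotientAddGroup.mk y : discGroup L).out : dualSub L) : Fin L.n → ℚ) with hy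
  rw [show w = y + (w - y) by abel, cL_add, cL_int L _ _ x.2 h]
  simp

theorem dual_dual (L : EvenLattice) (x : Fin L.n → ℚ) (h : ∀ y ∈ dualSub L, cL L x y = 1) :
    x ∈ intSub L := by
  classical
  let Bq : Matrix (Fin L.n) (Fin L.n) ℚ := L.B.map (Int.cast : ℤ → ℚ)
  have hdet : IsUnit Bq.det := by
    have := (Int.castRingHom ℚ).map_det L.B
    have h2 : Bq.det = ((L.B.det : ℤ) : ℚ) := this.symm
    rw [h2, isUnit_iff_ne_zero]; exact_mod_cast L.nondeg
  have key : ∀ u v, formR L ℚ u (Bq⁻¹.mulVec v) = u ⬝ᵥ v := by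
    intro u v
    rw [formR_eq, Matrix.mulVec_mulVec, Matrix.mul_nonsing_inv _ hdet, Matrix.one_mulVec]
  intro i
  have h1 := h (Bq⁻¹.mulVec (Pi.single i 1)) ?_
  · rw [cL, exp_two_pi_int, key] at h1
    simpa using h1
  · intro y hy
    rw [formR_symm, key]
    obtain ⟨m, hm⟩ := hy i
    exact ⟨m, by simpa using hm⟩

theorem gauss_abs {A : Type*} [AddCommGroup A] [Fintype A] (F : A → ℂ) (χ : A → A → ℂ)
    (h0 : F 0 = 1) (hn : ∀ a, F a * starRingEnd ℂ (F a) = 1)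
    (hF : ∀ a b, F (a + b) = F a * F b * χ a b)
    (hχ : ∀ a b c, χ a (b + c) = χ a b * χ a c)
    (hne : ∀ a, a ≠ 0 → ∃ b, χ a b ≠ 1) :
    (∑ a, F a) * starRingEnd ℂ (∑ a, F a) = Fintype.card A := by
  classical
  have h1 : (∑ a, F a) * starRingEnd ℂ (∑ a, F a) = ∑ b, ∑ a, F (a + b) * starRingEnd ℂ (F b) := by
    rw [map_sum, Finset.mul_sum]
    refine Finset.sum_congr rfl fun b _ => ?_
    rw [Finset.sum_mul]
    exact (Equiv.sum_comp (Equiv.addRight b) (fun a => F a * starRingEnd ℂ (F b))).symm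
  rw [h1, Finset.sum_comm]
  have h2 : ∀ a, ∑ b, F (a + b) * starRingEnd ℂ (F b) = F a * ∑ b, χ a b := by
    intro a
    rw [Finset.mul_sum]
    refine Finset.sum_congr rfl fun b _ => ?_
    rw [hF]
    linear_combination (F a * χ a b) * hn b
  simp_rw [h2]
  rw [Finset.sum_eq_single 0]
  · have h3 : ∀ b, χ 0 b = 1 := by
      intro b
      have := hF 0 b
      rw [zero_add, h0, one_mul] at this
      have hb : F b ≠ 0 := by
        intro h; have := hn b; rw [h] at this; simp at this
      exact (mul_left_cancel₀ hb (by rw [← this, mul_one])).symm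
    simp [h3, h0]
  · intro a _ ha
    obtain ⟨c, hc⟩ := hne a ha
    have : ∑ b, χ a b = (∑ b, χ a b) * χ a c := by
      rw [Finset.sum_mul]
      simp_rw [← hχ]
      exact (Equiv.sum_comp (Equiv.addRight c) (fun b => χ a b)).symm
    have h4 : (∑ b, χ a b) * (χ a c - 1) = 0 := by linear_combination -this
    rcases mul_eq_zero.mp h4 with h5 | h5
    · rw [h5, mul_zero]
    · exact absurd (sub_eq_zero.mp h5) hc
  · simp

theorem gauss_norm (L : EvenLattice) [Fintype (discGroup L)] :
    (∑ a : discGroup L, fL L (a.out : Fin L.n → ℚ)) *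
      starRingEnd ℂ (∑ a : discGroup L, fL L (a.out : Fin L.n → ℚ)) = Fintype.card (discGroup L) := by
  refine gauss_abs _ (fun a b => cL L (a.out : Fin L.n → ℚ) (b.out : Fin L.n → ℚ)) ?_ ?_ ?_ ?_ ?_
  · have := fL_mk L 0
    rw [QuotientAddGroup.mk_zero] at this
    rw [this, fL_int L _ (by exact (intSub L).zero_mem)]
  · intro a
    rw [Complex.mul_conj, Complex.normSq_eq_norm_sq, fL]
    have : (Real.pi * Complex.I * ((formR L ℚ (a.out : Fin L.n → ℚ) (a.out : Fin L.n → ℚ) : ℚ) : ℂ))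
      = ((Real.pi * (formR L ℚ (a.out : Fin L.n → ℚ) (a.out : Fin L.n → ℚ) : ℚ) : ℝ) : ℂ) * Complex.I := by
      push_cast; ring
    rw [this, Complex.norm_exp_ofReal_mul_I]
    simp
  · intro a b
    have : a + b = QuotientAddGroup.mk (a.out + b.out) := by
      rw [QuotientAddGroup.mk_add]
      congr 1 <;> exact (Quotient.out_eq' _).symm
    rw [this, fL_mk, AddSubgroup.coe_add, fL_add]
  · intro a b c
    have : b + c = QuotientAddGroup.mk (b.out + c.out) := by
      rw [QuotientAddGroup.mk_add]
      congr 1 <;> exact (Quotient.out_eq' _).symm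
    rw [this, cL_mk, AddSubgroup.coe_add, cL_add]
  · intro a ha
    by_contra! hcon
    apply ha
    have h1 : (a.out : Fin L.n → ℚ) ∈ intSub L := by
      apply dual_dual
      intro y hy
      have := hcon (QuotientAddGroup.mk ⟨y, hy⟩)
      rwa [cL_mk] at this
    have h2 : a = QuotientAddGroup.mk a.out := (Quotient.out_eq' _).symm
    rw [h2, QuotientAddGroup.eq_zero_iff]
    exact h1

theorem avg_lemma {A : Type*} [AddCommGroup A] [Fintype A] (F : A → ℂ) (H : AddSubgroup A)
    (K : A → Prop) [DecidablePred K] (h1 : ∀ a, K a → ∀ h ∈ H, F (a + h) = F a)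
    (h2 : ∀ a, ¬ K a → ∃ h0 ∈ H, ∃ c : ℂ, c ≠ 1 ∧ ∀ h ∈ H, F (a + h + h0) = c * F (a + h)) :
    ∑ a, F a = ∑ a with K a, F a := by
  classical
  have e1 : (Fintype.card H : ℂ) * ∑ a, F a = ∑ a, ∑ h : H, F (a + h) := by
    rw [Finset.sum_comm, ← nsmul_eq_mul, ← Finset.card_univ, ← Finset.sum_const]
    refine Finset.sum_congr rfl fun h _ => ?_
    exact (Equiv.sum_comp (Equiv.addRight (h : A)) F).symm
  have e2 : ∀ a, ∑ h : H, F (a + h) = if K a then (Fintype.card H : ℂ) * F a else 0 := by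
    intro a
    split_ifs with hK
    · rw [Finset.sum_congr rfl fun (h : H) _ => h1 a hK h h.2]
      simp
    · obtain ⟨h0, hh0, c, hc, hch⟩ := h2 a hK
      have : ∑ h : H, F (a + h) = c * ∑ h : H, F (a + h) := by
        rw [Finset.mul_sum, ← Equiv.sum_comp (Equiv.addRight (⟨h0, hh0⟩ : H)) (fun h : H => F (a + h))]
        refine Finset.sum_congr rfl fun h _ => ?_
        rw [← hch h h.2, add_assoc]
        rfl
      have h4 : (∑ h : H, F (a + h)) * (c - 1) = 0 := by linear_combination -this
      rcases mul_eq_zero.mp h4 with h5 | h5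
      · exact h5
      · exact absurd (sub_eq_zero.mp h5) hc
  have hc : (Fintype.card H : ℂ) ≠ 0 := by
    exact_mod_cast Fintype.card_ne_zero
  apply mul_left_cancel₀ hc
  rw [e1, Finset.mul_sum, Finset.sum_filter]
  exact Finset.sum_congr rfl fun a _ => e2 a

theorem gauss_zmod (m : ℕ) [NeZero m] (hm : Even m) :
    (∑ j : ZMod m, Complex.exp (Real.pi * Complex.I * (j.val : ℂ) ^ 2 / m)) =
     (Real.sqrt m : ℂ) * Complex.exp (Real.pi * Complex.I / 4) := by
  rw [← gauss_sum_eq m hm]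
  rcases m with _ | m
  · exact absurd rfl (NeZero.ne 0)
  · rfl

theorem gauss_int (d : ℤ) [NeZero d.natAbs] (hd : Even d) :
    (∑ j : ZMod d.natAbs, Complex.exp (Real.pi * Complex.I * (j.val : ℂ) ^ 2 / d)) =
     (Real.sqrt d.natAbs : ℂ) * Complex.exp (Real.pi * Complex.I * (d.sign : ℂ) / 4) := by
  have h := gauss_zmod d.natAbs (by simpa using hd)
  have hd0 : d ≠ 0 := by simpa using NeZero.ne d.natAbs
  rcases lt_or_gt_of_ne hd0 with h0 | h0
  · have h1 : (d : ℂ) = -(d.natAbs : ℂ) := by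
      have : d = -(d.natAbs : ℤ) := by omega
      exact_mod_cast this
    have h2 := congrArg (starRingEnd ℂ) h
    rw [map_sum, map_mul, ← Complex.exp_conj] at h2
    rw [Int.sign_eq_neg_one_of_neg h0, h1]
    convert h2 using 1
    · refine Finset.sum_congr rfl fun j _ => ?_
      rw [← Complex.exp_conj]
      congr 1
      simp only [map_div₀, map_mul, map_pow, Complex.conj_ofReal, Complex.conj_I, map_natCast]
      rw [div_neg]
      ring
    · rw [Complex.conj_ofReal]
      congr 2
      simp only [map_div₀, map_mul, Complex.conj_ofReal, Complex.conj_I, map_ofNat]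
      push_cast
      ring
  · have h1 : (d : ℂ) = (d.natAbs : ℂ) := by
      have : d = (d.natAbs : ℤ) := by omega
      have h3 := congrArg (Int.cast : ℤ → ℂ) this
      rwa [Int.cast_natCast] at h3
    rw [Int.sign_eq_one_of_pos h0, h1, Int.cast_one, mul_one]
    exact h

theorem reduction (L : EvenLattice) (P : Matrix (Fin L.n) (Fin L.n) ℤ) (d : Fin L.n → ℤ)
    (hd0 : ∀ i, d i ≠ 0) (hd : P.transpose * L.B * P = Matrix.diagonal d) :
    Finite (discGroup L) ∧ ∀ [Fintype (discGroup L)], ∃ c r : ℝ, 0 < c ∧ 0 < r ∧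
      (c : ℂ) * ∑ a : discGroup L, fL L (a.out : Fin L.n → ℚ) =
        r * Complex.exp (Real.pi * Complex.I / 4 * ∑ i, ((d i).sign : ℂ)) := by
  classical
  have hdq : ∀ i, (d i : ℚ) ≠ 0 := fun i => by exact_mod_cast hd0 i
  have hnz : ∀ i, NeZero (d i).natAbs := fun i => ⟨by simpa using hd0 i⟩
  let ι : (Fin L.n → ℤ) → (Fin L.n → ℚ) := fun k i => (k i : ℚ)
  have hι_add : ∀ k l, ι (k + l) = ι k + ι l := by intro k l; ext i; simp [ι]
  have hι_mem : ∀ k, ι k ∈ intSub L := fun k i => ⟨k i, rfl⟩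
  let Bq : Matrix (Fin L.n) (Fin L.n) ℚ := L.B.map (Int.cast : ℤ → ℚ)
  let Pq : Matrix (Fin L.n) (Fin L.n) ℚ := P.map (Int.cast : ℤ → ℚ)
  let C : Matrix (Fin L.n) (Fin L.n) ℤ := P.transpose * L.B
  let Cm : Matrix (Fin L.n) (Fin L.n) ℚ := Pq.transpose * Bq
  let Tm : Matrix (Fin L.n) (Fin L.n) ℚ := Pq * Matrix.diagonal (fun i => (d i : ℚ)⁻¹)
  have hmap : ∀ (M : Matrix (Fin L.n) (Fin L.n) ℤ) z, ι (M.mulVec z) = (M.map (Int.cast : ℤ → ℚ)).mulVec (ι z) := by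
    intro M z; ext i; simp [ι, Matrix.mulVec, dotProduct]
  have hCm : C.map (Int.cast : ℤ → ℚ) = Cm := by
    ext i j; simp [C, Cm, Pq, Bq, Matrix.mul_apply]
  have hBT : Bq.transpose = Bq := by
    ext i j
    simp only [Bq, Matrix.transpose_apply, Matrix.map_apply]
    rw [L.symm.apply]
  have hCP : Cm * Pq = Matrix.diagonal (fun i => (d i : ℚ)) := by
    have := congrArg (fun M : Matrix (Fin L.n) (Fin L.n) ℤ => M.map (Int.castRingHom ℚ)) hd
    simp only [Matrix.map_mul, Matrix.transpose_map] at this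
    refine (this.trans ?_)
    rw [Matrix.diagonal_map (map_zero _)]
    rfl
  have hCT : Cm * Tm = 1 := by
    simp only [Tm]
    rw [← Matrix.mul_assoc, hCP, Matrix.diagonal_mul_diagonal]
    ext i j
    simp [Matrix.diagonal_apply, Matrix.one_apply, hdq]
  have hTC : Tm * Cm = 1 := mul_eq_one_comm.mp hCT
  let T : (Fin L.n → ℚ) → (Fin L.n → ℚ) := fun k => Tm.mulVec k
  have hT_add : ∀ k l, T (k + l) = T k + T l := fun k l => Matrix.mulVec_add _ _ _
  have hT : ∀ x, T (Cm.mulVec x) = x := fun x => by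
    simp only [T]; rw [Matrix.mulVec_mulVec, hTC, Matrix.one_mulVec]
  have hTC' : ∀ z, T (ι (C.mulVec z)) = ι z := fun z => by rw [hmap, hCm, hT]
  have hform : ∀ x w, formR L ℚ x (Pq.mulVec w) = (Cm.mulVec x) ⬝ᵥ w := by
    intro x w
    rw [formR_eq, Matrix.mulVec_mulVec, Matrix.dotProduct_mulVec, ← Matrix.mulVec_transpose,
      Matrix.transpose_mul]
    change ((Pq.transpose * Bq.transpose).mulVec x) ⬝ᵥ w = _
    rw [hBT]
  have hPw : ∀ w : Fin L.n → ℤ, T (ι (fun i => d i * w i)) = Pq.mulVec (ι w) := by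
    intro w
    simp only [T, Tm]
    rw [← Matrix.mulVec_mulVec]
    congr 1
    ext i
    rw [Matrix.mulVec_diagonal]
    simp [ι, hdq]
  have hPmem : ∀ w : Fin L.n → ℤ, Pq.mulVec (ι w) ∈ intSub L := by
    intro w
    have := hι_mem (P.mulVec w)
    rwa [hmap] at this
  have hCTv : ∀ k, Cm.mulVec (T k) = k := fun k => by
    simp only [T]; rw [Matrix.mulVec_mulVec, hCT, Matrix.one_mulVec]
  have hper : ∀ k w : Fin L.n → ℤ, fL L (T (ι (k + fun i => d i * w i))) = fL L (T (ι k)) := by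
    intro k w
    rw [hι_add, hT_add, hPw, fL_add, fL_int L _ (hPmem w)]
    have : cL L (T (ι k)) (Pq.mulVec (ι w)) = 1 := by
      rw [cL, exp_two_pi_int, hform, hCTv]
      exact ⟨k ⬝ᵥ w, by simp [ι, dotProduct]⟩
    rw [this]; simp
  -- the finite group
  let A := (i : Fin L.n) → ZMod (d i).natAbs
  let red : (Fin L.n → ℤ) →+ A := AddMonoidHom.mk' (fun k i => (k i : ZMod (d i).natAbs))
    (by intro a b; funext i; exact Int.cast_add _ _)
  let lift : A → (Fin L.n → ℤ) := fun a i => ((a i).val : ℤ)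
  have hlift : ∀ a, red (lift a) = a := by
    intro a; funext i
    simp [red, lift]
  have hred : ∀ k k', red k = red k' → ∃ w : Fin L.n → ℤ, k' = k + fun i => d i * w i := by
    intro k k' h
    have : ∀ i, ∃ w, k' i = k i + d i * w := by
      intro i
      have h1 : (k i : ZMod (d i).natAbs) = k' i := congrFun h i
      rw [ZMod.intCast_eq_intCast_iff_dvd_sub, Int.natAbs_dvd] at h1
      obtain ⟨w, hw⟩ := h1
      exact ⟨w, by linarith⟩
    choose w hw using this
    exact ⟨w, funext hw⟩
  let F : A → ℂ := fun a => fL L (T (ι (lift a)))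
  have hF : ∀ k, F (red k) = fL L (T (ι k)) := by
    intro k
    obtain ⟨w, hw⟩ := hred k (lift (red k)) (hlift _).symm
    simp only [F]
    rw [hw, hper]
  have hκ : ∀ x : dualSub L, ∃ k, T (ι k) = x := by
    intro x
    have : ∀ i, ∃ m : ℤ, (m : ℚ) = Cm.mulVec (x : Fin L.n → ℚ) i := by
      intro i
      obtain ⟨m, hm⟩ := x.2 (Pq.mulVec (ι (Pi.single i 1))) (hPmem _)
      refine ⟨m, ?_⟩
      rw [← hm, hform]
      have : ι (Pi.single i 1) = Pi.single i 1 := by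
        ext j
        by_cases h : j = i
        · subst h; simp [ι]
        · simp [ι, h]
      rw [this]; simp
    choose k hk using this
    refine ⟨k, ?_⟩
    have : ι k = Cm.mulVec (x : Fin L.n → ℚ) := funext hk
    rw [this, hT]
  choose κ hκ using hκ
  have hinj : ∀ k k', red k = red k' → T (ι k') - T (ι k) ∈ intSub L := by
    intro k k' h
    obtain ⟨w, rfl⟩ := hred k k' h
    rw [hι_add, hT_add, hPw]
    simpa using hPmem w
  have hmk : ∀ b b' : discGroup L, (b'.out : Fin L.n → ℚ) - (b.out : Fin L.n → ℚ) ∈ intSub L → b = b' := by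
    intro b b' h
    have h1 : (QuotientAddGroup.mk b.out : discGroup L) = QuotientAddGroup.mk b'.out := by
      rw [QuotientAddGroup.eq, AddSubgroup.mem_addSubgroupOf]
      simpa [sub_eq_neg_add] using h
    have h2 : ∀ a : discGroup L, QuotientAddGroup.mk a.out = a := fun a => Quotient.out_eq' _
    rw [h2, h2] at h1
    exact h1
  refine ⟨Finite.of_injective (fun b : discGroup L => red (κ b.out)) ?_, ?_⟩
  · intro b b' h
    have := hinj _ _ h
    rw [hκ, hκ] at this
    exact hmk _ _ this
  intro _
  let ψ : (Fin L.n → ℤ) →+ A := red.comp C.mulVecLin.toAddMonoidHom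
  have hψ : ∀ z, ψ z = red (C.mulVec z) := fun z => rfl
  let H : AddSubgroup A := ψ.range
  have havg := avg_lemma F H (fun a => T (ι (lift a)) ∈ dualSub L) ?_ ?_
  rotate_left
  · rintro a ha _ ⟨z, rfl⟩
    rw [hψ]
    nth_rw 1 [← hlift a]
    rw [← map_add, hF, hι_add, hT_add, hTC', fL_add, fL_int L _ (hι_mem z), cL_int L _ _ ha (hι_mem z)]
    simp [F]
  · intro a ha
    have : ∃ y ∈ intSub L, ¬ ∃ m : ℤ, formR L ℚ (T (ι (lift a))) y = m := by
      by_contra! hcon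
      exact ha hcon
    obtain ⟨y, hy, hne⟩ := this
    obtain ⟨z, rfl⟩ := (mem_intSub_iff L y).mp hy
    refine ⟨ψ z, ⟨z, rfl⟩, cL L (T (ι (lift a))) (ι z), ?_, ?_⟩
    · intro h
      rw [cL, exp_two_pi_int] at h
      exact hne h
    · rintro _ ⟨w, rfl⟩
      rw [hψ, hψ]
      have e2 : F (a + red (C.mulVec w)) = fL L (T (ι (lift a)) + ι w) := by
        rw [← hTC' w, ← hT_add, ← hι_add, ← hF, map_add, hlift]
      have e1 : F (a + red (C.mulVec w) + red (C.mulVec z)) = fL L (T (ι (lift a)) + ι w + ι z) := by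
        rw [← hTC' w, ← hTC' z, ← hT_add, ← hι_add, ← hT_add, ← hι_add, ← hF, map_add, map_add, hlift]
      rw [e1, e2, fL_add L (_ + _), fL_int L _ (hι_mem z), cL_add_left, cL_int L (ι w) (ι z) (intSub_le_dual L (hι_mem w)) (hι_mem z)]
      ring
  have hK : ∑ a with T (ι (lift a)) ∈ dualSub L, F a =
      (Fintype.card H : ℂ) * ∑ a : discGroup L, fL L (a.out : Fin L.n → ℚ) := by
    have hdl : ∀ k, T (ι k) ∈ dualSub L → T (ι (lift (red k))) ∈ dualSub L := by
      intro k hk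
      obtain ⟨w, hw⟩ := hred k (lift (red k)) (hlift _).symm
      rw [hw, hι_add, hT_add, hPw]
      exact (dualSub L).add_mem hk (intSub_le_dual L (hPmem w))
    have hTinj : ∀ k k', T (ι k) = T (ι k') → k = k' := by
      intro k k' h
      have h1 := congrArg Cm.mulVec h
      rw [hCTv, hCTv] at h1
      funext i
      have h2 := congrFun h1 i
      simp only [ι] at h2
      exact_mod_cast h2
    have hs : (Fintype.card H : ℂ) * ∑ a : discGroup L, fL L (a.out : Fin L.n → ℚ) =
        ∑ p : discGroup L × H, fL L (p.1.out : Fin L.n → ℚ) := by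
      rw [Fintype.sum_prod_type, Finset.mul_sum]
      refine Finset.sum_congr rfl fun b _ => ?_
      simp
    rw [hs]
    symm
    refine Finset.sum_bij (fun p _ => red (κ p.1.out) + (p.2 : A)) ?_ ?_ ?_ ?_
    · rintro ⟨b, ⟨_, ⟨z, rfl⟩⟩⟩ _
      rw [Finset.mem_filter]
      refine ⟨Finset.mem_univ _, ?_⟩
      simp only [hψ]
      rw [← map_add]
      apply hdl
      rw [hι_add, hT_add, hTC', hκ]
      exact (dualSub L).add_mem b.out.2 (intSub_le_dual L (hι_mem z))
    · rintro ⟨b, ⟨_, ⟨z, rfl⟩⟩⟩ _ ⟨b', ⟨_, ⟨z', rfl⟩⟩⟩ _ h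
      simp only [hψ] at h
      have h' := h
      rw [← map_add, ← map_add] at h
      have h1 := hinj _ _ h
      rw [hι_add, hT_add, hTC', hκ, hι_add, hT_add, hTC', hκ] at h1
      have h2 : b = b' := by
        apply hmk
        have h3 := (intSub L).add_mem h1 ((intSub L).sub_mem (hι_mem z) (hι_mem z'))
        convert h3 using 1
        abel
      subst h2
      have h4 := add_left_cancel h'
      refine Prod.ext rfl (Subtype.ext ?_)
      exact h4
    · intro a ha
      rw [Finset.mem_filter] at ha
      have h1 := mk_out_sub L ⟨_, ha.2⟩
      obtain ⟨y, hy⟩ := (mem_intSub_iff L _).mp h1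
      refine ⟨(QuotientAddGroup.mk ⟨_, ha.2⟩, ⟨ψ (-y), ⟨-y, rfl⟩⟩), Finset.mem_univ _, ?_⟩
      have h2 : κ (QuotientAddGroup.mk (⟨_, ha.2⟩ : dualSub L) : discGroup L).out = lift a + C.mulVec y := by
        apply hTinj
        rw [hκ, hι_add, hT_add, hTC']
        exact (sub_eq_iff_eq_add'.mp hy)
      change red (κ (QuotientAddGroup.mk (⟨_, ha.2⟩ : dualSub L) : discGroup L).out) + ψ (-y) = a
      rw [h2, map_add, hlift, map_neg, hψ]
      abel
    · rintro ⟨b, ⟨_, ⟨z, rfl⟩⟩⟩ _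
      simp only [hψ]
      rw [← map_add, hF, hι_add, hT_add, hTC', hκ, fL_add, fL_int L _ (hι_mem z),
        cL_int L _ _ b.out.2 (hι_mem z)]
      simp
  refine ⟨Fintype.card H, ∏ i, Real.sqrt (d i).natAbs, ?_, ?_, ?_⟩
  · exact_mod_cast Fintype.card_pos
  · refine Finset.prod_pos fun i _ => Real.sqrt_pos.mpr ?_
    exact_mod_cast Nat.pos_of_ne_zero (NeZero.ne (d i).natAbs)
  have hde : ∀ i, Even (d i) := by
    intro i
    obtain ⟨m, hm⟩ := formR_even L (fun j => P j i)
    have h1 := congrFun (congrFun hd i) i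
    rw [Matrix.diagonal_apply_eq] at h1
    rw [even_iff_two_dvd]
    refine ⟨m, ?_⟩
    rw [← hm, ← h1, formR, Matrix.mul_assoc, Matrix.mul_apply]
    refine Finset.sum_congr rfl fun k _ => ?_
    rw [Matrix.mul_apply, Finset.mul_sum]
    refine Finset.sum_congr rfl fun l _ => ?_
    simp only [Matrix.transpose_apply, Int.cast_id]
    ring
  have hFv : ∀ a, F a = ∏ i, Complex.exp (Real.pi * Complex.I * ((a i).val : ℂ) ^ 2 / d i) := by
    intro a
    have h1 : formR L ℚ (T (ι (lift a))) (T (ι (lift a))) = ∑ i, ((a i).val : ℚ) ^ 2 / d i := by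
      have : T (ι (lift a)) = Pq.mulVec ((Matrix.diagonal (fun i => (d i : ℚ)⁻¹)).mulVec (ι (lift a))) := by
        rw [Matrix.mulVec_mulVec]
      nth_rw 2 [this]
      rw [hform, hCTv]
      refine Finset.sum_congr rfl fun i _ => ?_
      rw [Matrix.mulVec_diagonal]
      have : ι (lift a) i = ((a i).val : ℚ) := Int.cast_natCast _
      rw [this]
      ring
    simp only [F, fL]
    rw [h1, ← Complex.exp_sum]
    congr 1
    rw [Rat.cast_sum, Finset.mul_sum]
    refine Finset.sum_congr rfl fun i _ => ?_
    rw [Rat.cast_div, Rat.cast_pow, Rat.cast_natCast, Rat.cast_intCast]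
    ring
  have hprod : ∑ a, F a = ∏ i, ∑ j : ZMod (d i).natAbs,
      Complex.exp (Real.pi * Complex.I * (j.val : ℂ) ^ 2 / d i) := by
    rw [Finset.prod_univ_sum, Fintype.piFinset_univ]
    exact Finset.sum_congr rfl fun a _ => hFv a
  rw [Complex.ofReal_natCast, ← hK, ← havg, hprod, Finset.prod_congr rfl fun i _ => gauss_int (d i) (hde i),
    Finset.prod_mul_distrib, ← Complex.exp_sum, Complex.ofReal_prod]
  congr 2
  rw [Finset.mul_sum]
  refine Finset.sum_congr rfl fun i _ => ?_
  ring

/-- **Milgram's formula.** For an even lattice `L` with discriminant form `(L^*/L, q_L)` and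
signature `(n₊, n₋)`, one has
`|L^*/L|^{-1/2} · Σ_{x ∈ L^*/L} e^{πi q_L(x)} = e^{2πi (n₊ - n₋)/8}`. -/
theorem milgram (L : EvenLattice) :
    ((Real.sqrt (Nat.card (discGroup L)) : ℂ))⁻¹ * (∑ᶠ x : discGroup L, expPiI (discQ L x)) =
      Complex.exp (2 * Real.pi * Complex.I * ((sigPlus L : ℂ) - (sigMinus L : ℂ)) / 8) := by
  classical
  obtain ⟨P, d, hP, hd⟩ := exists_diag L
  have hd0 : ∀ i, d i ≠ 0 := by
    have h1 := congrArg Matrix.det hd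
    rw [Matrix.det_mul, Matrix.det_mul, Matrix.det_transpose, Matrix.det_diagonal] at h1
    have h2 : ∏ i, d i ≠ 0 := by
      rw [← h1]
      exact mul_ne_zero (mul_ne_zero hP L.nondeg) hP
    intro i
    exact Finset.prod_ne_zero_iff.mp h2 i (Finset.mem_univ i)
  obtain ⟨hfin, hred⟩ := reduction L P d hd0 hd
  letI : Fintype (discGroup L) := Fintype.ofFinite _
  obtain ⟨c, r, hc, hr, h⟩ := hred
  have hn := gauss_norm L
  obtain ⟨hp, hm⟩ := sig_eq L P d hP hd
  have hsum : ∑ i, ((d i).sign : ℂ) = (sigPlus L : ℂ) - (sigMinus L : ℂ) := by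
    rw [hp, hm, Set.ncard_eq_toFinset_card', Set.ncard_eq_toFinset_card']
    simp only [Set.toFinset_setOf]
    rw [Finset.card_filter, Finset.card_filter]
    push_cast
    rw [← Finset.sum_sub_distrib]
    refine Finset.sum_congr rfl fun i _ => ?_
    rcases lt_or_gt_of_ne (hd0 i) with h0 | h0
    · rw [Int.sign_eq_neg_one_of_neg h0, if_neg (by omega), if_pos h0]; simp
    · rw [Int.sign_eq_one_of_pos h0, if_pos h0, if_neg (by omega)]; simp
  rw [hsum] at h
  rw [finsum_eq_sum_of_fintype, Nat.card_eq_fintype_card]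
  simp only [expPiI_discQ]
  set G := ∑ a : discGroup L, fL L (a.out : Fin L.n → ℚ) with hG
  have hθ : Complex.exp (2 * Real.pi * Complex.I * ((sigPlus L : ℂ) - (sigMinus L : ℂ)) / 8) =
      Complex.exp ((Real.pi / 4 * ((sigPlus L : ℝ) - (sigMinus L : ℝ)) : ℝ) * Complex.I) := by
    congr 1; push_cast; ring
  have hθ' : Complex.exp (Real.pi * Complex.I / 4 * ((sigPlus L : ℂ) - (sigMinus L : ℂ))) =
      Complex.exp ((Real.pi / 4 * ((sigPlus L : ℝ) - (sigMinus L : ℝ)) : ℝ) * Complex.I) := by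
    congr 1; push_cast; ring
  rw [hθ]
  rw [hθ'] at h
  set E := Complex.exp ((Real.pi / 4 * ((sigPlus L : ℝ) - (sigMinus L : ℝ)) : ℝ) * Complex.I) with hE
  have hEn : ‖E‖ = 1 := Complex.norm_exp_ofReal_mul_I _
  rw [Complex.mul_conj, Complex.normSq_eq_norm_sq] at hn
  have hn' : ‖G‖ ^ 2 = (Fintype.card (discGroup L) : ℝ) := by exact_mod_cast hn
  have hs : Real.sqrt (Fintype.card (discGroup L)) = ‖G‖ := by
    rw [← hn', Real.sqrt_sq (norm_nonneg _)]
  have hcG : c * ‖G‖ = r := by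
    have h1 := congrArg norm h
    rw [norm_mul, norm_mul, hEn, Complex.norm_real, Complex.norm_real, Real.norm_of_nonneg hc.le,
      Real.norm_of_nonneg hr.le, mul_one] at h1
    exact h1
  have hGn : ‖G‖ ≠ 0 := by
    intro h0
    rw [h0, mul_zero] at hcG
    exact hr.ne hcG
  have hcC : (c : ℂ) ≠ 0 := by exact_mod_cast hc.ne'
  have hGC : (‖G‖ : ℂ) ≠ 0 := by exact_mod_cast hGn
  rw [hs, inv_mul_eq_iff_eq_mul₀ hGC]
  apply mul_left_cancel₀ hcC
  rw [h, ← hcG]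
  push_cast
  ring
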